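/- Let T > 0, σ_X > 0, σ_Y > 0, γ° > 0, real constants ûθ and ûa, and continuous functions β1, β3 : [0,T] → ℝ. Define α(t, χ) := β3(t) + β1(t)·χ and δ1(t, χ) := ûθ + ûa·α(t, χ). Then the initial value problem γ'(t) = −γ(t)²·α(t, χ(t))²/σ_Y² with γ(0) = γ°, and χ'(t) = γ(t)·α(t, χ(t))²·(1 − χ(t))/σ_Y² − γ(t)·χ(t)²·δ1(t, χ(t))²/σ_X² with χ(0) = 0, has a unique C¹ solution (γ, χ) on [0,T], and it satisfies 0 < γ(t) ≤ γ° and 0 ≤ χ(t) < 1 for all t ∈ [0,T]. If moreover β3(0) ≠ 0, then γ(t) < γ° and χ(t) > 0 for all t ∈ (0,T]. -/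

import Mathlib

open Set

/-- A pair `(γ, χ)` solving the learning ODEs of the signaling game with private
monitoring, for strategy coefficients `(β1, β3)` and myopic best-response
weight `δ1 = ûθ + ûa·α` where `α = β3 + β1·χ`. -/
def LearnSol (T σX σY γo uθ ua : ℝ) (β1 β3 γ χ : ℝ → ℝ) : Prop :=
  ContDiffOn ℝ 1 γ (Icc 0 T) ∧ ContDiffOn ℝ 1 χ (Icc 0 T) ∧
  (∀ t ∈ Icc (0:ℝ) T,
    HasDerivWithinAt γ (-(γ t)^2 * (β3 t + β1 t * χ t)^2 / σY^2) (Icc 0 T) t) ∧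
  (∀ t ∈ Icc (0:ℝ) T,
    HasDerivWithinAt χ
      (γ t * (β3 t + β1 t * χ t)^2 * (1 - χ t) / σY^2
        - γ t * (χ t)^2 * (uθ + ua * (β3 t + β1 t * χ t))^2 / σX^2) (Icc 0 T) t) ∧
  γ 0 = γo ∧ χ 0 = 0

open Metric
open scoped NNReal

section Comparison

variable {y y' : ℝ → ℝ} {a b K : ℝ}

lemma hasDerivWithinAt_Ici_of_Icc {E : Type*} [NormedAddCommGroup E] [NormedSpace ℝ E]
    {f : ℝ → E} {f' : E} {t : ℝ} (ht : t ∈ Ico a b) (hf : HasDerivWithinAt f f' (Icc a b) t) :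
    HasDerivWithinAt f f' (Ici t) t :=
  hf.mono_of_mem_nhdsWithin (Icc_mem_nhdsGE_of_mem ht)

lemma hasDerivAt_const_mul_exp (c k a t : ℝ) :
    HasDerivAt (fun s => c * Real.exp (k * (s - a))) (c * (Real.exp (k * (t - a)) * k)) t := by
  have h : HasDerivAt (fun s => k * (s - a)) k t := by
    simpa using ((hasDerivAt_id t).sub_const a).const_mul k
  exact h.exp.const_mul c

/-- A function starting from a positive value whose relative rate of decrease is bounded stays
positive. -/
lemma pos_of_neg_mul_le_deriv
    (hy : ∀ t ∈ Icc a b, HasDerivWithinAt y (y' t) (Icc a b) t) (ha : 0 < y a)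
    (h : ∀ t ∈ Icc a b, 0 < y t → -(K * y t) ≤ y' t) : ∀ t ∈ Icc a b, 0 < y t := by
  intro t ht
  have key := image_le_of_deriv_right_lt_deriv_boundary' (f := fun s => -y s)
    (f' := fun s => -y' s) (a := a) (b := b)
    (B := fun s => -y a * Real.exp (-(K + 1) * (s - a)))
    (B' := fun s => -y a * (Real.exp (-(K + 1) * (s - a)) * -(K + 1)))
    (fun s hs => (hy s hs).continuousWithinAt.neg)
    (fun s hs => (hasDerivWithinAt_Ici_of_Icc hs (hy s (Ico_subset_Icc_self hs))).neg)
    (by simp) (by fun_prop)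
    (fun s _ => (hasDerivAt_const_mul_exp _ _ _ _).hasDerivWithinAt)
    (fun s hs hs' => by
      have hpos := mul_pos ha (Real.exp_pos (-(K + 1) * (s - a)))
      have := h s (Ico_subset_Icc_self hs) (by linarith)
      have hB : -y a * (Real.exp (-(K + 1) * (s - a)) * -(K + 1)) = (K + 1) * y s := by
        linear_combination (K + 1) * hs'
      simp only [hB]
      linarith) ht
  have hpos := mul_pos ha (Real.exp_pos (-(K + 1) * (t - a)))
  linarith

/-- A function starting from a nonnegative value whose derivative is bounded below by a multiple
of its value wherever it is negative stays nonnegative. -/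
lemma nonneg_of_mul_le_deriv
    (hy : ∀ t ∈ Icc a b, HasDerivWithinAt y (y' t) (Icc a b) t) (ha : 0 ≤ y a)
    (h : ∀ t ∈ Icc a b, y t < 0 → K * y t ≤ y' t) : ∀ t ∈ Icc a b, 0 ≤ y t := by
  intro t ht
  have key : ∀ ε > 0, -y t ≤ ε * Real.exp ((K + 1) * (t - a)) := fun ε hε =>
    image_le_of_deriv_right_lt_deriv_boundary' (f := fun s => -y s)
      (f' := fun s => -y' s) (a := a) (b := b)
      (B := fun s => ε * Real.exp ((K + 1) * (s - a)))
      (B' := fun s => ε * (Real.exp ((K + 1) * (s - a)) * (K + 1)))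
      (fun s hs => (hy s hs).continuousWithinAt.neg)
      (fun s hs => (hasDerivWithinAt_Ici_of_Icc hs (hy s (Ico_subset_Icc_self hs))).neg)
      (by simp; linarith) (by fun_prop)
      (fun s _ => (hasDerivAt_const_mul_exp _ _ _ _).hasDerivWithinAt)
      (fun s hs hs' => by
        have hpos := mul_pos hε (Real.exp_pos ((K + 1) * (s - a)))
        have := h s (Ico_subset_Icc_self hs) (by linarith)
        have hB : ε * (Real.exp ((K + 1) * (s - a)) * (K + 1)) = -((K + 1) * y s) := by
          linear_combination -(K + 1) * hs'
        simp only [hB]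
        linarith) ht
  by_contra! hneg
  have hE := Real.exp_pos ((K + 1) * (t - a))
  have := key (-y t / (2 * Real.exp ((K + 1) * (t - a)))) (by apply div_pos <;> linarith)
  rw [div_mul_eq_mul_div, le_div_iff₀ (by positivity)] at this
  nlinarith

lemma le_of_deriv_nonpos (hy : ∀ t ∈ Icc a b, HasDerivWithinAt y (y' t) (Icc a b) t)
    (h : ∀ t ∈ Icc a b, y' t ≤ 0) {s t : ℝ} (has : a ≤ s) (hst : s ≤ t) (htb : t ≤ b) :
    y t ≤ y s := by
  have hsub : Icc s t ⊆ Icc a b := Icc_subset_Icc has htb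
  have := nonneg_of_mul_le_deriv (K := 0) (y := fun r => y s - y r) (y' := fun r => -y' r)
    (a := s) (b := t) (fun r hr => ((hy r (hsub hr)).mono hsub).const_sub _) (by simp)
    (fun r hr _ => by have := h r (hsub hr); linarith) t ⟨hst, le_rfl⟩
  linarith

lemma deriv_eq_zero_of_const_on {c d : ℝ} (hac : a < c) (hcb : c ≤ b)
    (hy : HasDerivWithinAt y d (Icc a b) a) (h : ∀ t ∈ Icc a c, y t = y a) : d = 0 := by
  have h1 : HasDerivWithinAt y d (Icc a c) a := hy.mono (Icc_subset_Icc_right hcb)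
  have h2 : HasDerivWithinAt y 0 (Icc a c) a :=
    (hasDerivWithinAt_const a (Icc a c) (y a)).congr h rfl
  exact (uniqueDiffOn_Icc hac a ⟨le_rfl, hac.le⟩).eq_deriv _ h1 h2

lemma contDiffOn_one_Icc_of_hasDerivWithinAt (hab : a < b)
    (hy : ∀ t ∈ Icc a b, HasDerivWithinAt y (y' t) (Icc a b) t)
    (hc : ContinuousOn y' (Icc a b)) : ContDiffOn ℝ 1 y (Icc a b) :=
  (contDiffOn_one_iff_derivWithin (uniqueDiffOn_Icc hab)).2
    ⟨fun t ht => (hy t ht).differentiableWithinAt,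
      hc.congr fun t ht => (hy t ht).derivWithin (uniqueDiffOn_Icc hab t ht)⟩

end Comparison

section Truncation

/-- The truncation of a real number to `[-R, R]`. -/
noncomputable def clamp (R x : ℝ) : ℝ := max (-R) (min R x)

lemma clamp_eq_self {R x : ℝ} (h : |x| ≤ R) : clamp R x = x := by
  rw [abs_le] at h
  rw [clamp, min_eq_right h.2, max_eq_right h.1]

lemma abs_clamp_le {R : ℝ} (hR : 0 ≤ R) (x : ℝ) : |clamp R x| ≤ R :=
  abs_le.2 ⟨le_max_left _ _, max_le (by linarith) (min_le_left _ _)⟩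

lemma lipschitzWith_clamp (R : ℝ) : LipschitzWith 1 (clamp R) :=
  (LipschitzWith.id.const_min R).const_max (-R)

lemma clamp_nonneg {R x : ℝ} (hR : 0 ≤ R) (hx : 0 ≤ x) : 0 ≤ clamp R x :=
  le_max_of_le_right (le_min hR hx)

lemma clamp_le_self {R x : ℝ} (hx : -R ≤ x) : clamp R x ≤ x :=
  max_le hx (min_le_right _ _)

lemma self_le_clamp {R x : ℝ} (hx : x ≤ R) : x ≤ clamp R x :=
  le_max_of_le_right (le_min hx le_rfl)

lemma continuous_clamp (R : ℝ) : Continuous (clamp R) := (lipschitzWith_clamp R).continuous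

/-- Solutions of the truncated learning ODEs, with squared signaling rates `A` and `D`, satisfy
the a priori bounds. -/
lemma truncated_bounds {T R γo : ℝ} {A D γ χ : ℝ → ℝ} (hR : 1 ≤ R) (hγo : 0 < γo)
    (hA : ContinuousOn A (Icc 0 T)) (hD : ContinuousOn D (Icc 0 T))
    (hA0 : ∀ t, 0 ≤ A t) (hD0 : ∀ t, 0 ≤ D t)
    (hγ : ∀ t ∈ Icc 0 T, HasDerivWithinAt γ (-(clamp R (γ t)) ^ 2 * A t) (Icc 0 T) t)
    (hχ : ∀ t ∈ Icc 0 T, HasDerivWithinAt χ (clamp R (γ t) * A t * (1 - clamp R (χ t))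
      - clamp R (γ t) * clamp R (χ t) ^ 2 * D t) (Icc 0 T) t)
    (h0 : γ 0 = γo) (h0' : χ 0 = 0) :
    ∀ t ∈ Icc 0 T, 0 < γ t ∧ γ t ≤ γo ∧ 0 ≤ χ t ∧ χ t < 1 := by
  obtain ⟨MA, hMA⟩ := isCompact_Icc.exists_bound_of_continuousOn hA
  obtain ⟨MD, hMD⟩ := isCompact_Icc.exists_bound_of_continuousOn hD
  replace hMA : ∀ t ∈ Icc 0 T, A t ≤ MA := fun t ht => (le_abs_self _).trans (hMA t ht)
  replace hMD : ∀ t ∈ Icc 0 T, D t ≤ MD := fun t ht => (le_abs_self _).trans (hMD t ht)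
  have hclamp (x : ℝ) : clamp R x ≤ R := (abs_le.1 (abs_clamp_le (by linarith) x)).2
  have hpos : ∀ t ∈ Icc 0 T, 0 < γ t := by
    refine pos_of_neg_mul_le_deriv (K := R * MA) hγ (h0 ▸ hγo) fun t ht hp => ?_
    have h1 := clamp_nonneg (R := R) (by linarith) hp.le
    have h2 : clamp R (γ t) ≤ γ t := clamp_le_self (by linarith)
    have h3 : clamp R (γ t) * clamp R (γ t) ≤ R * γ t := mul_le_mul (hclamp _) h2 h1 (by linarith)
    have h4 := mul_le_mul h3 (hMA t ht) (hA0 t) (by nlinarith)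
    linarith
  have hg (t) (ht : t ∈ Icc 0 T) : 0 ≤ clamp R (γ t) := clamp_nonneg (by linarith) (hpos t ht).le
  have hnn : ∀ t ∈ Icc 0 T, 0 ≤ χ t := by
    refine nonneg_of_mul_le_deriv (K := R * R * MD) hχ h0'.ge fun t ht hn => ?_
    have h1 : χ t ≤ clamp R (χ t) := self_le_clamp (by linarith)
    have h2 : clamp R (χ t) ≤ 0 := max_le (by linarith) ((min_le_right _ _).trans hn.le)
    have h3 : -R ≤ clamp R (χ t) := le_max_left _ _
    have h4 : 0 ≤ clamp R (γ t) * A t * (1 - clamp R (χ t)) :=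
      mul_nonneg (mul_nonneg (hg t ht) (hA0 t)) (by linarith)
    have h5 : clamp R (χ t) ^ 2 ≤ R * -χ t := by nlinarith
    have h6 : clamp R (γ t) * clamp R (χ t) ^ 2 ≤ R * (R * -χ t) :=
      mul_le_mul (hclamp _) h5 (sq_nonneg _) (by linarith)
    have h7 := mul_le_mul h6 (hMD t ht) (hD0 t) (by nlinarith)
    linarith
  have hlt : ∀ t ∈ Icc 0 T, 0 < 1 - χ t := by
    refine pos_of_neg_mul_le_deriv (K := R * MA) (fun t ht => (hχ t ht).const_sub 1)
      (by simp [h0']) fun t ht hp => ?_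
    have h1 : χ t ≤ clamp R (χ t) := self_le_clamp (by linarith)
    have h3 : 0 ≤ clamp R (γ t) * clamp R (χ t) ^ 2 * D t :=
      mul_nonneg (mul_nonneg (hg t ht) (sq_nonneg _)) (hD0 t)
    have h4 := mul_nonneg (hg t ht) (hA0 t)
    have h5 : clamp R (γ t) * A t ≤ R * MA :=
      mul_le_mul (hclamp _) (hMA t ht) (hA0 t) (by linarith)
    nlinarith [mul_le_mul_of_nonneg_right h5 hp.le, mul_nonneg h4 (sub_nonneg.2 h1)]
  refine fun t ht => ⟨hpos t ht, ?_, hnn t ht, by linarith [hlt t ht]⟩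
  rw [← h0]
  exact le_of_deriv_nonpos hγ
    (fun s _ => by nlinarith [mul_nonneg (sq_nonneg (clamp R (γ s))) (hA0 s)]) le_rfl ht.1 ht.2

end Truncation

section Field

/-- The right-hand side of the learning ODEs as a function of `((β1, β3), (γ, χ))`. -/
noncomputable def learnField (σX σY uθ ua : ℝ) (z : (ℝ × ℝ) × (ℝ × ℝ)) : ℝ × ℝ :=
  (-(z.2.1) ^ 2 * (z.1.2 + z.1.1 * z.2.2) ^ 2 / σY ^ 2,
    z.2.1 * (z.1.2 + z.1.1 * z.2.2) ^ 2 * (1 - z.2.2) / σY ^ 2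
      - z.2.1 * z.2.2 ^ 2 * (uθ + ua * (z.1.2 + z.1.1 * z.2.2)) ^ 2 / σX ^ 2)

lemma contDiff_learnField (σX σY uθ ua : ℝ) : ContDiff ℝ 1 (learnField σX σY uθ ua) := by
  unfold learnField
  fun_prop

/-- The right-hand side of the learning ODEs with the state truncated to `[-R, R] × [-R, R]`. -/
noncomputable def truncField (σX σY uθ ua : ℝ) (β1 β3 : ℝ → ℝ) (R t : ℝ) (p : ℝ × ℝ) : ℝ × ℝ :=
  learnField σX σY uθ ua ((β1 t, β3 t), (clamp R p.1, clamp R p.2))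

variable {T : ℝ} {β1 β3 : ℝ → ℝ} (σX σY uθ ua : ℝ)

lemma exists_lipschitz_bound_truncField (hβ1 : ContinuousOn β1 (Icc 0 T))
    (hβ3 : ContinuousOn β3 (Icc 0 T)) {R : ℝ} (hR : 0 ≤ R) :
    ∃ K L : ℝ≥0, ∀ t ∈ Icc 0 T, LipschitzWith K (truncField σX σY uθ ua β1 β3 R t) ∧
      ∀ p, ‖truncField σX σY uθ ua β1 β3 R t p‖ ≤ L := by
  obtain ⟨M, hM⟩ := isCompact_Icc.exists_bound_of_continuousOn (hβ1.prodMk hβ3)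
  have hF := contDiff_learnField σX σY uθ ua
  have hcomp : IsCompact (closedBall (0 : (ℝ × ℝ) × (ℝ × ℝ)) (max M R)) :=
    isCompact_closedBall _ _
  obtain ⟨L, hL⟩ := hcomp.exists_bound_of_continuousOn hF.continuous.continuousOn
  obtain ⟨K, hK⟩ := hF.contDiffOn.exists_lipschitzOnWith one_ne_zero (convex_closedBall _ _) hcomp
  have hmem (t) (ht : t ∈ Icc 0 T) (p : ℝ × ℝ) :
      ((β1 t, β3 t), (clamp R p.1, clamp R p.2)) ∈
        closedBall (0 : (ℝ × ℝ) × (ℝ × ℝ)) (max M R) := by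
    rw [mem_closedBall_zero_iff]
    exact max_le_max (hM t ht) (max_le (abs_clamp_le hR _) (abs_clamp_le hR _))
  refine ⟨K * 1, L.toNNReal, fun t ht => ⟨?_, fun p =>
    (hL _ (hmem t ht p)).trans (Real.le_coe_toNNReal L)⟩⟩
  have hc : LipschitzWith 1 fun p : ℝ × ℝ => ((β1 t, β3 t), (clamp R p.1, clamp R p.2)) := by
    have h1 := (lipschitzWith_clamp R).comp (LipschitzWith.prod_fst (α := ℝ) (β := ℝ))
    have h2 := (lipschitzWith_clamp R).comp (LipschitzWith.prod_snd (α := ℝ) (β := ℝ))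
    simpa using (LipschitzWith.const (β1 t, β3 t)).prodMk (h1.prodMk h2)
  rw [← lipschitzOnWith_univ] at hc ⊢
  exact hK.comp hc fun p _ => hmem t ht p

lemma exists_truncField_solution (hT : 0 ≤ T) (hβ1 : ContinuousOn β1 (Icc 0 T))
    (hβ3 : ContinuousOn β3 (Icc 0 T)) {R : ℝ} (hR : 0 ≤ R) (p₀ : ℝ × ℝ) :
    ∃ p : ℝ → ℝ × ℝ, p 0 = p₀ ∧ ∀ t ∈ Icc 0 T,
      HasDerivWithinAt p (truncField σX σY uθ ua β1 β3 R t (p t)) (Icc 0 T) t := by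
  obtain ⟨K, L, h⟩ := exists_lipschitz_bound_truncField σX σY uθ ua hβ1 hβ3 hR
  have hPL : IsPicardLindelof (truncField σX σY uθ ua β1 β3 R)
      (⟨0, le_rfl, hT⟩ : Icc 0 T) p₀ (L * T.toNNReal) 0 L K :=
    { lipschitzOnWith := fun t ht => (h t ht).1.lipschitzOnWith
      continuousOn := fun x _ => (contDiff_learnField σX σY uθ ua).continuous.comp_continuousOn
        ((hβ1.prodMk hβ3).prodMk continuousOn_const)
      norm_le := fun t ht x _ => (h t ht).2 x
      mul_max_le := by simp [hT] }
  exact hPL.exists_eq_forall_mem_Icc_hasDerivWithinAt₀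

lemma truncField_solution_unique (hβ1 : ContinuousOn β1 (Icc 0 T))
    (hβ3 : ContinuousOn β3 (Icc 0 T)) {R : ℝ} (hR : 0 ≤ R) {p q : ℝ → ℝ × ℝ} (h0 : p 0 = q 0)
    (hp : ∀ t ∈ Icc 0 T,
      HasDerivWithinAt p (truncField σX σY uθ ua β1 β3 R t (p t)) (Icc 0 T) t)
    (hq : ∀ t ∈ Icc 0 T,
      HasDerivWithinAt q (truncField σX σY uθ ua β1 β3 R t (q t)) (Icc 0 T) t) :
    EqOn p q (Icc 0 T) := by
  obtain ⟨K, L, h⟩ := exists_lipschitz_bound_truncField σX σY uθ ua hβ1 hβ3 hR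
  exact ODE_solution_unique_of_mem_Icc_right (s := fun _ => univ)
    (fun t ht => (h t (Ico_subset_Icc_self ht)).1.lipschitzOnWith)
    (fun t ht => (hp t ht).continuousWithinAt)
    (fun t ht => hasDerivWithinAt_Ici_of_Icc ht (hp t (Ico_subset_Icc_self ht)))
    (fun _ _ => mem_univ _)
    (fun t ht => (hq t ht).continuousWithinAt)
    (fun t ht => hasDerivWithinAt_Ici_of_Icc ht (hq t (Ico_subset_Icc_self ht)))
    (fun _ _ => mem_univ _) h0

variable {σX σY uθ ua} {γo : ℝ} {γ χ : ℝ → ℝ}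

lemma LearnSol.hasDerivWithinAt_truncField (h : LearnSol T σX σY γo uθ ua β1 β3 γ χ) {R : ℝ}
    (hγ : ∀ t ∈ Icc 0 T, |γ t| ≤ R) (hχ : ∀ t ∈ Icc 0 T, |χ t| ≤ R) :
    ∀ t ∈ Icc 0 T, HasDerivWithinAt (fun s => (γ s, χ s))
      (truncField σX σY uθ ua β1 β3 R t (γ t, χ t)) (Icc 0 T) t := by
  intro t ht
  simp only [truncField, clamp_eq_self (hγ t ht), clamp_eq_self (hχ t ht)]
  exact (h.2.2.1 t ht).prodMk (h.2.2.2.1 t ht)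

lemma exists_learnSol (hT : 0 < T) (hγo : 0 < γo) (hβ1 : ContinuousOn β1 (Icc 0 T))
    (hβ3 : ContinuousOn β3 (Icc 0 T)) :
    ∃ γ χ : ℝ → ℝ, LearnSol T σX σY γo uθ ua β1 β3 γ χ ∧
      ∀ t ∈ Icc 0 T, 0 < γ t ∧ γ t ≤ γo ∧ 0 ≤ χ t ∧ χ t < 1 := by
  set R := max γo 1
  have hR1 : 1 ≤ R := le_max_right _ _
  obtain ⟨p, hp0, hp⟩ := exists_truncField_solution σX σY uθ ua hT.le hβ1 hβ3
    (zero_le_one.trans hR1) (γo, 0)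
  set γ : ℝ → ℝ := fun t => (p t).1
  set χ : ℝ → ℝ := fun t => (p t).2
  have hγ (t) (ht : t ∈ Icc 0 T) :
      HasDerivWithinAt γ (truncField σX σY uθ ua β1 β3 R t (p t)).1 (Icc 0 T) t :=
    (ContinuousLinearMap.fst ℝ ℝ ℝ).hasFDerivAt.comp_hasDerivWithinAt t (hp t ht)
  have hχ (t) (ht : t ∈ Icc 0 T) :
      HasDerivWithinAt χ (truncField σX σY uθ ua β1 β3 R t (p t)).2 (Icc 0 T) t :=
    (ContinuousLinearMap.snd ℝ ℝ ℝ).hasFDerivAt.comp_hasDerivWithinAt t (hp t ht)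
  have hγc : ContinuousOn γ (Icc 0 T) := fun t ht => (hγ t ht).continuousWithinAt
  have hχc : ContinuousOn χ (Icc 0 T) := fun t ht => (hχ t ht).continuousWithinAt
  have hcχ : ContinuousOn (fun t => clamp R (χ t)) (Icc 0 T) :=
    (continuous_clamp R).comp_continuousOn hχc
  have hbd := truncated_bounds (R := R) (γ := γ) (χ := χ)
    (A := fun t => (β3 t + β1 t * clamp R (χ t)) ^ 2 / σY ^ 2)
    (D := fun t => (uθ + ua * (β3 t + β1 t * clamp R (χ t))) ^ 2 / σX ^ 2) hR1 hγo
    (by fun_prop) (by fun_prop) (fun t => by positivity) (fun t => by positivity)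
    (fun t ht => (hγ t ht).congr_deriv (by simp only [truncField, learnField, γ, χ]; ring))
    (fun t ht => (hχ t ht).congr_deriv (by simp only [truncField, learnField, γ, χ]; ring))
    (by simp [γ, hp0]) (by simp [χ, hp0])
  have hcl (t) (ht : t ∈ Icc 0 T) : clamp R (γ t) = γ t ∧ clamp R (χ t) = χ t := by
    obtain ⟨h1, h2, h3, h4⟩ := hbd t ht
    exact ⟨clamp_eq_self ((abs_of_pos h1).trans_le (h2.trans (le_max_left _ _))),
      clamp_eq_self ((abs_of_nonneg h3).trans_le (h4.le.trans hR1))⟩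
  have hγ' : ∀ t ∈ Icc 0 T,
      HasDerivWithinAt γ (-(γ t) ^ 2 * (β3 t + β1 t * χ t) ^ 2 / σY ^ 2) (Icc 0 T) t :=
    fun t ht => (hγ t ht).congr_deriv (by
      simp only [truncField, learnField]
      rw [show clamp R (p t).1 = γ t from (hcl t ht).1,
        show clamp R (p t).2 = χ t from (hcl t ht).2])
  have hχ' : ∀ t ∈ Icc 0 T, HasDerivWithinAt χ
      (γ t * (β3 t + β1 t * χ t) ^ 2 * (1 - χ t) / σY ^ 2
        - γ t * (χ t) ^ 2 * (uθ + ua * (β3 t + β1 t * χ t)) ^ 2 / σX ^ 2) (Icc 0 T) t :=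
    fun t ht => (hχ t ht).congr_deriv (by
      simp only [truncField, learnField]
      rw [show clamp R (p t).1 = γ t from (hcl t ht).1,
        show clamp R (p t).2 = χ t from (hcl t ht).2])
  exact ⟨γ, χ, ⟨contDiffOn_one_Icc_of_hasDerivWithinAt hT hγ' (by fun_prop),
    contDiffOn_one_Icc_of_hasDerivWithinAt hT hχ' (by fun_prop), hγ', hχ',
    by simp [γ, hp0], by simp [χ, hp0]⟩, hbd⟩

lemma LearnSol.unique (hβ1 : ContinuousOn β1 (Icc 0 T)) (hβ3 : ContinuousOn β3 (Icc 0 T))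
    (h : LearnSol T σX σY γo uθ ua β1 β3 γ χ) {γ' χ' : ℝ → ℝ}
    (h' : LearnSol T σX σY γo uθ ua β1 β3 γ' χ') :
    ∀ t ∈ Icc 0 T, γ' t = γ t ∧ χ' t = χ t := by
  obtain ⟨R, hR⟩ := isCompact_Icc.exists_bound_of_continuousOn
    ((h.1.continuousOn.prodMk h.2.1.continuousOn).prodMk
      (h'.1.continuousOn.prodMk h'.2.1.continuousOn))
  intro t ht
  have hb (s) (hs : s ∈ Icc 0 T) : (|γ s| ≤ R ∧ |χ s| ≤ R) ∧ |γ' s| ≤ R ∧ |χ' s| ≤ R := by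
    simpa [Prod.norm_def] using hR s hs
  have := truncField_solution_unique σX σY uθ ua hβ1 hβ3 ((abs_nonneg _).trans (hb t ht).1.1)
    (by simp only [h.2.2.2.2.1, h.2.2.2.2.2, h'.2.2.2.2.1, h'.2.2.2.2.2])
    (h'.hasDerivWithinAt_truncField (fun s hs => (hb s hs).2.1) fun s hs => (hb s hs).2.2)
    (h.hasDerivWithinAt_truncField (fun s hs => (hb s hs).1.1) fun s hs => (hb s hs).1.2) ht
  simpa using this

lemma LearnSol.strict_bounds (hσY : 0 < σY) (hγo : 0 < γo)
    (hβ1 : ContinuousOn β1 (Icc 0 T)) (hβ3 : ContinuousOn β3 (Icc 0 T))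
    (h : LearnSol T σX σY γo uθ ua β1 β3 γ χ)
    (hbd : ∀ t ∈ Icc 0 T, 0 < γ t ∧ γ t ≤ γo ∧ 0 ≤ χ t ∧ χ t < 1) (hβ : β3 0 ≠ 0) :
    ∀ t ∈ Ioc 0 T, γ t < γo ∧ 0 < χ t := by
  obtain ⟨hγ1, hχ1, hγ, hχ, h0, h0'⟩ := h
  have hγc := hγ1.continuousOn
  have hχc := hχ1.continuousOn
  rintro t ⟨ht0, htT⟩
  have hT0 : (0 : ℝ) ∈ Icc 0 T := ⟨le_rfl, ht0.le.trans htT⟩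
  have hne : γo * β3 0 ^ 2 / σY ^ 2 ≠ 0 := by positivity
  constructor
  · refine lt_of_le_of_ne (hbd t ⟨ht0.le, htT⟩).2.1 fun heq => hne ?_
    have hz := deriv_eq_zero_of_const_on ht0 htT (hγ 0 hT0) fun s hs => by
      rw [h0]
      refine le_antisymm (hbd s ⟨hs.1, hs.2.trans htT⟩).2.1 (heq ▸ ?_)
      refine le_of_deriv_nonpos hγ (fun r _ => ?_) hs.1 hs.2 htT
      rw [neg_mul, neg_div]
      exact neg_nonpos.2 (by positivity)
    rw [h0, h0'] at hz
    have : γo * (γo * β3 0 ^ 2 / σY ^ 2) = 0 := by linear_combination -hz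
    exact (mul_eq_zero.1 this).resolve_left hγo.ne'
  · refine lt_of_le_of_ne (hbd t ⟨ht0.le, htT⟩).2.2.1 fun heq => hne ?_
    obtain ⟨M, hM⟩ := isCompact_Icc.exists_bound_of_continuousOn
      (f := fun s => γ s * χ s * (uθ + ua * (β3 s + β1 s * χ s)) ^ 2 / σX ^ 2)
      (s := Icc 0 T) (by fun_prop)
    have hz := deriv_eq_zero_of_const_on ht0 htT (hχ 0 hT0) fun s hs => by
      rw [h0']
      by_contra hs0
      have hsT : Icc s T ⊆ Icc 0 T := Icc_subset_Icc_left hs.1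
      have hspos : 0 < χ s :=
        lt_of_le_of_ne (hbd s ⟨hs.1, hs.2.trans htT⟩).2.2.1 (Ne.symm hs0)
      refine (pos_of_neg_mul_le_deriv (K := M) (fun r hr => (hχ r (hsT hr)).mono hsT) hspos
        (fun r hr hr0 => ?_) t ⟨hs.2, htT⟩).ne heq
      obtain ⟨h1, -, -, h4⟩ := hbd r (hsT hr)
      have h5 := mul_le_mul_of_nonneg_right ((le_abs_self _).trans (hM r (hsT hr))) hr0.le
      have h6 : 0 ≤ γ r * (β3 r + β1 r * χ r) ^ 2 * (1 - χ r) / σY ^ 2 := by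
        have := sub_pos.2 h4
        positivity
      have h7 : γ r * χ r ^ 2 * (uθ + ua * (β3 r + β1 r * χ r)) ^ 2 / σX ^ 2 =
        γ r * χ r * (uθ + ua * (β3 r + β1 r * χ r)) ^ 2 / σX ^ 2 * χ r := by ring
      linarith
    rw [h0, h0'] at hz
    linear_combination hz

end Field

/-- Existence, uniqueness and bounds for the learning ODEs
(Cisternas–Kolb, Lemma "Learning ODEs"). -/
theorem stmt_6 (T σX σY γo uθ ua : ℝ) (hT : 0 < T) (hσX : 0 < σX) (hσY : 0 < σY)
    (hγo : 0 < γo) (β1 β3 : ℝ → ℝ)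
    (hβ1 : ContinuousOn β1 (Icc 0 T)) (hβ3 : ContinuousOn β3 (Icc 0 T)) :
    ∃ γ χ : ℝ → ℝ, LearnSol T σX σY γo uθ ua β1 β3 γ χ ∧
      (∀ γ' χ' : ℝ → ℝ, LearnSol T σX σY γo uθ ua β1 β3 γ' χ' →
        ∀ t ∈ Icc (0:ℝ) T, γ' t = γ t ∧ χ' t = χ t) ∧
      (∀ t ∈ Icc (0:ℝ) T, 0 < γ t ∧ γ t ≤ γo ∧ 0 ≤ χ t ∧ χ t < 1) ∧
      (β3 0 ≠ 0 → ∀ t ∈ Ioc (0:ℝ) T, γ t < γo ∧ 0 < χ t) := by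
  obtain ⟨γ, χ, h, hbd⟩ := exists_learnSol (σX := σX) (σY := σY) (uθ := uθ) (ua := ua)
    hT hγo hβ1 hβ3
  exact ⟨γ, χ, h, fun γ' χ' h' => h.unique hβ1 hβ3 h', hbd, h.strict_bounds hσY hγo hβ1 hβ3 hbd⟩
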